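/- arXiv:cs/0202025 — 10 statements merged into one kernel-verified Lean document; each statement's English description precedes it below -/
import Mathlib

section
/- Given a set X and a binary relation R on X, there exists a total preorder S on X (a reflexive, transitive relation such that for all x, y ∈ X, x S y or y S x) that extends R (i.e., x R y implies x S y) and satisfies: for all x, y ∈ X, if x S y and y S x then x R* y, where R* is the reflexive and transitive closure of R. -/
/-- Lemma 2.1: any binary relation `R` on a set `X` extends to a total preorder `S`
such that mutually `S`-related elements are related by the reflexive-transitive
closure of `R`. -/
theorem extend_to_total_preorder {X : Type*} (R : X → X → Prop) :
    ∃ S : X → X → Prop,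
      (∀ x, S x x) ∧
      (∀ x y z, S x y → S y z → S x z) ∧
      (∀ x y, S x y ∨ S y x) ∧
      (∀ x y, R x y → S x y) ∧
      (∀ x y, S x y → S y x → Relation.ReflTransGen R x y) := by
  let _ : Preorder X :=
    { le := Relation.ReflTransGen R
      le_refl := fun _ => Relation.ReflTransGen.refl
      le_trans := fun _ _ _ => Relation.ReflTransGen.trans }
  let f : X → LinearExtension (Antisymmetrization X (· ≤ ·)) :=
    fun x => toLinearExtension (toAntisymmetrization (· ≤ ·) x)
  refine ⟨fun x y => f x ≤ f y, fun _ => le_rfl, fun _ _ _ => le_trans,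
    fun _ _ => le_total _ _, fun x y h => ?_, fun x y hxy hyx => ?_⟩
  · exact toLinearExtension.monotone
      (toAntisymmetrization_mono (Relation.ReflTransGen.single h : x ≤ y))
  · exact (Quotient.exact (le_antisymm hxy hyx : f x = f y)).1
end

section
/- The operation | is representable by a symmetric pseudo-distance d : U × U → Z if and only if | satisfies condition (|1) and the Loop condition (|S1). -/
/-- The set of elements of `B` closest to `A` under the pseudo-distance `d`. -/
def distRev {U Z : Type*} [LinearOrder Z] (d : U → U → Z) (A B : Set U) : Set U :=
  {b | b ∈ B ∧ ∃ a ∈ A, ∀ a' ∈ A, ∀ b' ∈ B, d a b ≤ d a' b'}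

/-- The Loop condition (|S1). -/
def LoopCond {U : Type*} (Y : Set (Set U)) (op : Set U → Set U → Set U) : Prop :=
  ∀ (k : ℕ) (X : ℕ → Set U), 1 ≤ k → (∀ i ≤ k, X i ∈ Y) →
    (∀ i, 1 ≤ i → i < k → ((op (X i) (X (i - 1) ∪ X (i + 1))) ∩ X (i - 1)).Nonempty) →
    ((op (X k) (X (k - 1) ∪ X 0)) ∩ X (k - 1)).Nonempty →
    ((op (X 0) (X k ∪ X 1)) ∩ X 1).Nonempty

/-- Every preorder admits a monotone map to a linear order that does not merge strict inequalities. -/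
theorem exists_linearOrder_map_of_preorder.{u} {α : Type u} (r : α → α → Prop)
    (hrefl : ∀ a, r a a) (htrans : ∀ a b c, r a b → r b c → r a c) :
    ∃ (Z : Type u) (_ : LinearOrder Z) (f : α → Z),
      (∀ a b, r a b → f a ≤ f b) ∧ ∀ a b, f a ≤ f b → r b a → r a b := by
  let _ : Preorder α := { le := r, le_refl := hrefl, le_trans := htrans }
  let f : α → LinearExtension (Antisymmetrization α (· ≤ ·)) :=
    fun a => toLinearExtension (toAntisymmetrization (· ≤ ·) a)
  have hf : ∀ a b, r a b → f a ≤ f b := fun a b h =>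
    toLinearExtension.monotone (toAntisymmetrization_mono h)
  refine ⟨LinearExtension (Antisymmetrization α (· ≤ ·)), inferInstance, f, hf, ?_⟩
  intro a b hab hba
  have h : f a = f b := le_antisymm hab (hf b a hba)
  exact (Quotient.exact (s := AntisymmRel.setoid α (· ≤ ·)) h).1

/-- Two consecutive edges `(A, B)`, `(B, C)` of a walk in `Y` such that, according to `op`,
the first is at most as long as the second. -/
def EdgeStep {U : Type*} (Y : Set (Set U)) (op : Set U → Set U → Set U)
    (p q : Set U × Set U) : Prop :=
  p.1 ∈ Y ∧ p.2 ∈ Y ∧ q.2 ∈ Y ∧ p.2 = q.1 ∧ (op p.2 (p.1 ∪ q.2) ∩ p.1).Nonempty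

/-- The preorder on edges generated by `EdgeStep`. -/
def EdgeLE {U : Type*} (Y : Set (Set U)) (op : Set U → Set U → Set U) :
    Set U × Set U → Set U × Set U → Prop :=
  Relation.ReflTransGen (EdgeStep Y op)

theorem EdgeLE.exists_walk {U : Type*} {Y : Set (Set U)} {op : Set U → Set U → Set U}
    {p q : Set U × Set U} (hp₁ : p.1 ∈ Y) (hp₂ : p.2 ∈ Y) (h : EdgeLE Y op p q) :
    ∃ (k : ℕ) (X : ℕ → Set U), X 0 = p.1 ∧ X 1 = p.2 ∧ X k = q.1 ∧ X (k + 1) = q.2 ∧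
      (∀ i ≤ k + 1, X i ∈ Y) ∧
      ∀ i, 1 ≤ i → i < k + 1 → (op (X i) (X (i - 1) ∪ X (i + 1)) ∩ X (i - 1)).Nonempty := by
  induction h with
  | refl =>
    refine ⟨0, fun i => if i = 0 then p.1 else p.2, by simp, by simp, by simp, by simp, ?_, ?_⟩
    · intro i _
      dsimp only
      split_ifs <;> assumption
    · intro i h₁ h₂
      omega
  | @tail b c _ hbc ih =>
    obtain ⟨k, X, h₀, h₁, hk, hk', hY, hs⟩ := ih
    obtain ⟨_, _, hc, hb, hne⟩ := hbc
    refine ⟨k + 1, fun i => if i = k + 2 then c.2 else X i, by simp [h₀], by simp [h₁],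
      by simp [hk', hb], by simp, ?_, ?_⟩
    · intro i hi
      dsimp only
      split_ifs
      · exact hc
      · exact hY i (by omega)
    · intro i hi hi'
      dsimp only
      rw [if_neg (by omega : i ≠ k + 2), if_neg (by omega : i - 1 ≠ k + 2)]
      by_cases h : i = k + 1
      · subst h
        simpa [hk, hk'] using hne
      · rw [if_neg (by omega)]
        exact hs i hi (by omega)

theorem LoopCond.of_edgeLE {U : Type*} {Y : Set (Set U)} {op : Set U → Set U → Set U}
    (hloop : LoopCond Y op) (hne : ∀ A ∈ Y, ∀ B ∈ Y, (op A B ∩ B).Nonempty)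
    {A B C : Set U} (hA : A ∈ Y) (hB : B ∈ Y) (h : EdgeLE Y op (A, B) (C, A)) :
    (op A (C ∪ B) ∩ B).Nonempty := by
  obtain ⟨k, X, h₀, h₁, hk, hk', hY, hs⟩ := h.exists_walk hA hB
  simp only at h₀ h₁ hk hk'
  rcases Nat.eq_zero_or_pos k with rfl | hpos
  · have hCA : C = A := hk.symm.trans h₀
    have hBA : B = A := h₁.symm.trans hk'
    rw [hCA, hBA, Set.union_self]
    exact hne A hA A hA
  · have hX := hloop k X hpos (fun i hi => hY i (by omega))
      (fun i hi hi' => hs i hi (by omega))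
      (by simpa [hk', h₀] using hs k hpos (by omega))
    rwa [h₀, h₁, hk] at hX

/-- The points of `B ∪ C` closest to `A` meet `B` exactly when `B` is at least as close to `A`
as `C`. -/
theorem distRev_union_inter_nonempty_iff {U Z : Type*} [LinearOrder Z] {d : U → U → Z}
    {A B C : Set U} (hB : (distRev d A B).Nonempty) :
    (distRev d A (B ∪ C) ∩ B).Nonempty ↔
      ∀ a' ∈ A, ∀ c ∈ C, ∃ a ∈ A, ∃ b ∈ B, d a b ≤ d a' c := by
  constructor
  · rintro ⟨b, ⟨_, a, ha, hmin⟩, hb⟩ a' ha' c hc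
    exact ⟨a, ha, b, hb, hmin a' ha' c (Or.inr hc)⟩
  · intro h
    obtain ⟨b, hb, a, ha, hmin⟩ := hB
    refine ⟨b, ⟨Or.inl hb, a, ha, ?_⟩, hb⟩
    rintro a' ha' c (hc | hc)
    · exact hmin a' ha' c hc
    · obtain ⟨a'', ha'', b'', hb'', hle⟩ := h a' ha' c hc
      exact (hmin a'' ha'' b'' hb'').trans hle

theorem loopCond_of_distRev {U Z : Type*} [LinearOrder Z] {d : U → U → Z}
    (hsymm : ∀ a b, d a b = d b a) {Y : Set (Set U)}
    (hYunion : ∀ A ∈ Y, ∀ B ∈ Y, A ∪ B ∈ Y) {op : Set U → Set U → Set U}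
    (hne : ∀ A ∈ Y, ∀ B ∈ Y, (op A B).Nonempty)
    (hd : ∀ A ∈ Y, ∀ B ∈ Y, op A B = distRev d A B) : LoopCond Y op := by
  intro k X hk hX hs hlast
  have hcloser : ∀ A ∈ Y, ∀ B ∈ Y, ∀ C ∈ Y, (op A (B ∪ C) ∩ B).Nonempty ↔
      ∀ a' ∈ A, ∀ c ∈ C, ∃ a ∈ A, ∃ b ∈ B, d a b ≤ d a' c := by
    intro A hA B hB C hC
    rw [hd A hA _ (hYunion B hB C hC)]
    exact distRev_union_inter_nonempty_iff (hd A hA B hB ▸ hne A hA B hB)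
  have hchain : ∀ i, i + 1 ≤ k → ∀ a ∈ X i, ∀ b ∈ X (i + 1),
      ∃ a₀ ∈ X 0, ∃ b₀ ∈ X 1, d a₀ b₀ ≤ d a b := by
    intro i
    induction i with
    | zero => exact fun _ a ha b hb => ⟨a, ha, b, hb, le_rfl⟩
    | succ i ih =>
      intro hi a ha b hb
      obtain ⟨a', ha', b', hb', hle⟩ :=
        (hcloser _ (hX (i + 1) (by omega)) _ (hX i (by omega)) _ (hX (i + 2) (by omega))).1
          (hs (i + 1) (by omega) (by omega)) a ha b hb
      obtain ⟨a₀, ha₀, b₀, hb₀, hle'⟩ := ih (by omega) b' hb' a' ha'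
      exact ⟨a₀, ha₀, b₀, hb₀, hle'.trans (hsymm b' a' ▸ hle)⟩
  rw [Set.union_comm, hcloser _ (hX 0 (by omega)) _ (hX 1 hk) _ (hX k le_rfl)]
  intro a ha c hc
  obtain ⟨a', ha', b', hb', hle⟩ :=
    (hcloser _ (hX k le_rfl) _ (hX (k - 1) (by omega)) _ (hX 0 (by omega))).1 hlast c hc a ha
  obtain ⟨a₀, ha₀, b₀, hb₀, hle'⟩ :=
    hchain (k - 1) (by omega) b' hb' a' (by rwa [Nat.sub_add_cancel hk])
  exact ⟨a₀, ha₀, b₀, hb₀, hle'.trans (by rwa [hsymm b' a', hsymm a c])⟩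

theorem LoopCond.exists_distRev.{u} {U : Type u} {Y : Set (Set U)}
    (hYsingle : ∀ a : U, {a} ∈ Y)
    {op : Set U → Set U → Set U} (hne : ∀ A ∈ Y, ∀ B ∈ Y, (op A B).Nonempty)
    (hsub : ∀ A ∈ Y, ∀ B ∈ Y, op A B ⊆ B) (hloop : LoopCond Y op) :
    ∃ (Z : Type u) (_ : LinearOrder Z) (d : U → U → Z),
      (∀ a b : U, d a b = d b a) ∧ ∀ A ∈ Y, ∀ B ∈ Y, op A B = distRev d A B := by
  obtain ⟨Z, _, f, hf, hf'⟩ := exists_linearOrder_map_of_preorder (EdgeLE Y op)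
    (fun _ => Relation.ReflTransGen.refl) (fun _ _ _ => Relation.ReflTransGen.trans)
  have hne' : ∀ A ∈ Y, ∀ B ∈ Y, (op A B ∩ B).Nonempty := fun A hA B hB => by
    rw [Set.inter_eq_left.2 (hsub A hA B hB)]
    exact hne A hA B hB
  have hflip : ∀ A ∈ Y, ∀ B ∈ Y, EdgeLE Y op (A, B) (B, A) := fun A hA B hB =>
    .single ⟨hA, hB, hA, rfl, by simpa using hne' B hB A hA⟩
  have hstep : ∀ A ∈ Y, ∀ B ∈ Y, ∀ C ∈ Y, (op A (B ∪ C) ∩ B).Nonempty →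
      EdgeLE Y op (A, B) (A, C) := fun A hA B hB C hC h =>
    (hflip A hA B hB).tail ⟨hB, hA, hC, rfl, h⟩
  have hanti : ∀ A ∈ Y, ∀ B ∈ Y, ∀ C ∈ Y, C ⊆ B → EdgeLE Y op (A, B) (A, C) := by
    intro A hA B hB C hC hCB
    refine hstep A hA B hB C hC ?_
    rw [Set.union_eq_left.2 hCB]
    exact hne' A hA B hB
  have hchosen : ∀ A ∈ Y, ∀ B ∈ Y, ∀ b ∈ op A B, EdgeLE Y op (A, {b}) (A, B) := by
    intro A hA B hB b hb
    refine hstep A hA _ (hYsingle b) B hB ⟨b, ?_, rfl⟩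
    rwa [Set.union_eq_right.2 (Set.singleton_subset_iff.2 (hsub A hA B hB hb))]
  have hleft : ∀ A ∈ Y, ∀ a ∈ A, ∀ b, EdgeLE Y op (A, {b}) ({a}, {b}) := fun A hA a ha b =>
    ((hflip A hA _ (hYsingle b)).trans
      (hanti _ (hYsingle b) A hA _ (hYsingle a) (Set.singleton_subset_iff.2 ha))).trans
        (hflip _ (hYsingle b) _ (hYsingle a))
  have hpoint : ∀ A ∈ Y, ∀ B ∈ Y, ∀ a ∈ A, ∀ b ∈ B, EdgeLE Y op (A, B) ({a}, {b}) :=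
    fun A hA B hB a ha b hb =>
      (hanti A hA B hB _ (hYsingle b) (Set.singleton_subset_iff.2 hb)).trans (hleft A hA a ha b)
  have hattained : ∀ A ∈ Y, ∀ B ∈ Y, ∀ b ∈ op A B, ∃ a ∈ A, EdgeLE Y op ({a}, {b}) (A, B) := by
    intro A hA B hB b hb
    obtain ⟨a, ha⟩ := hne _ (hYsingle b) A hA
    exact ⟨a, hsub _ (hYsingle b) A hA ha,
      (((hflip _ (hYsingle a) _ (hYsingle b)).trans
        (hchosen _ (hYsingle b) A hA a ha)).trans (hflip _ (hYsingle b) A hA)).trans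
          (hchosen A hA B hB b hb)⟩
  refine ⟨Z, inferInstance, fun a b => f ({a}, {b}), fun a b => le_antisymm
    (hf _ _ (hflip _ (hYsingle a) _ (hYsingle b)))
    (hf _ _ (hflip _ (hYsingle b) _ (hYsingle a))), fun A hA B hB => ?_⟩
  ext b
  constructor
  · intro hb
    obtain ⟨a, ha, hab⟩ := hattained A hA B hB b hb
    exact ⟨hsub A hA B hB hb, a, ha, fun a' ha' b' hb' =>
      hf _ _ (hab.trans (hpoint A hA B hB a' ha' b' hb'))⟩
  · rintro ⟨hb, a, ha, hmin⟩
    obtain ⟨b₀, hb₀⟩ := hne A hA B hB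
    obtain ⟨a₀, ha₀, hab₀⟩ := hattained A hA B hB b₀ hb₀
    have hle : EdgeLE Y op ({a}, {b}) ({a₀}, {b₀}) :=
      hf' _ _ (hmin a₀ ha₀ b₀ (hsub A hA B hB hb₀))
        (hab₀.trans (hpoint A hA B hB a ha b hb))
    obtain ⟨x, hx, hxb⟩ := hloop.of_edgeLE hne' hA (hYsingle b)
      (((hleft A hA a ha b).trans (hle.trans hab₀)).trans (hflip A hA B hB))
    rw [Set.mem_singleton_iff.1 hxb,
      Set.union_eq_left.2 (Set.singleton_subset_iff.2 hb)] at hx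
    exact hx

/-- Proposition 2.2 (a): `op` is representable by a symmetric pseudo-distance iff
it satisfies (|1) and the Loop condition (|S1). -/
theorem representable_symmetric_iff {U : Type} [Nonempty U] (Y : Set (Set U))
    (hY0 : ∅ ∉ Y) (hYsingle : ∀ a : U, {a} ∈ Y)
    (hYinter : ∀ A ∈ Y, ∀ B ∈ Y, (A ∩ B).Nonempty → A ∩ B ∈ Y)
    (hYunion : ∀ A ∈ Y, ∀ B ∈ Y, A ∪ B ∈ Y)
    (op : Set U → Set U → Set U)
    (hop : ∀ A ∈ Y, ∀ B ∈ Y, op A B ∈ Y) :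
    (∃ (Z : Type) (_ : LinearOrder Z) (d : U → U → Z),
        (∀ a b : U, d a b = d b a) ∧
        ∀ A ∈ Y, ∀ B ∈ Y, op A B = distRev d A B) ↔
      ((∀ A ∈ Y, ∀ B ∈ Y, op A B ⊆ B) ∧ LoopCond Y op) := by
  have hne : ∀ A ∈ Y, ∀ B ∈ Y, (op A B).Nonempty := fun A hA B hB =>
    Set.nonempty_iff_ne_empty.2 fun h => hY0 (h ▸ hop A hA B hB)
  constructor
  · rintro ⟨Z, _, d, hsymm, hd⟩
    refine ⟨fun A hA B hB b hb => ?_, loopCond_of_distRev hsymm hYunion hne hd⟩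
    rw [hd A hA B hB] at hb
    exact hb.1
  · rintro ⟨hsub, hloop⟩
    exact hloop.exists_distRev hYsingle hne hsub
end

section
/- An operation | : 𝒴 × 𝒴 → 𝒴 on the nonempty subsets of a nonempty finite set U is representable by a pseudo-distance if and only if it satisfies conditions (|1), (|A1), (|A2) and (|A3) for all nonempty subsets A, B ⊆ U, where the relation R is generated by cases (1) and (2). -/
/-- The relation `R` on pairs of nonempty subsets of `U`, generated by cases (1) and (2)
of Definition 2.3. -/
def relR {U : Type*} (op : Set U → Set U → Set U) :
    Set U × Set U → Set U × Set U → Prop :=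
  fun p q =>
    p.1.Nonempty ∧ p.2.Nonempty ∧ q.1.Nonempty ∧ q.2.Nonempty ∧
    ((p.1 = q.1 ∧ ((op p.1 (p.2 ∪ q.2)) ∩ p.2).Nonempty) ∨
     (p.2 = q.2 ∧ op (p.1 ∪ q.1) p.2 ≠ op q.1 p.2))

/-- A relation `r` has a linear ranking that is monotone along the reflexive transitive closure
of `r` and does not identify points that the closure separates strictly. -/
lemma exists_linear_ranking {α : Type} (r : α → α → Prop) :
    ∃ (Z : Type) (_ : LinearOrder Z) (v : α → Z),
      (∀ x y, Relation.ReflTransGen r x y → v x ≤ v y) ∧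
      (∀ x y, Relation.ReflTransGen r x y → v y ≤ v x → Relation.ReflTransGen r y x) := by
  let _ : Preorder α :=
    { le := Relation.ReflTransGen r
      le_refl := fun _ => Relation.ReflTransGen.refl
      le_trans := fun _ _ _ => Relation.ReflTransGen.trans }
  refine ⟨LinearExtension (Antisymmetrization α (· ≤ ·)), inferInstance,
    fun x => toLinearExtension (toAntisymmetrization (· ≤ ·) x), ?_, ?_⟩
  · intro x y h
    exact toLinearExtension.monotone (toAntisymmetrization_mono h)
  · intro x y h h'
    have hmono := toLinearExtension.monotone (toAntisymmetrization_mono (show x ≤ y from h))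
    have heq : toAntisymmetrization (α := α) (· ≤ ·) x = toAntisymmetrization (· ≤ ·) y :=
      le_antisymm (α := LinearExtension (Antisymmetrization α (· ≤ ·))) hmono h'
    exact (Quotient.exact heq).2

lemma biUnion_union_singleton {U : Type*} (X : Set U) {T : Set U} (hT : T.Nonempty) :
    ⋃ t ∈ T, (X ∪ {t}) = X ∪ T := by
  simp only [Set.iUnion_union_distrib, Set.biUnion_const hT, Set.biUnion_of_singleton]

lemma biUnion_of_union_closed {U : Type*} {p : Set U → Prop}
    (hp : ∀ X Y : Set U, X.Nonempty → Y.Nonempty → p X → p Y → p (X ∪ Y))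
    {T : Set U} (hfin : T.Finite) (hne : T.Nonempty) {g : U → Set U}
    (hg : ∀ t, (g t).Nonempty) (hgp : ∀ t ∈ T, p (g t)) : p (⋃ t ∈ T, g t) := by
  induction T, hfin using Set.Finite.induction_on with
  | empty => exact absurd hne Set.not_nonempty_empty
  | @insert a T _ _ ih =>
    rw [Set.biUnion_insert]
    rcases T.eq_empty_or_nonempty with rfl | hT
    · simpa using hgp a (by simp)
    · obtain ⟨t, ht⟩ := hT
      refine hp _ _ (hg a) ?_ (hgp a (by simp)) (ih ⟨t, ht⟩ fun s hs => hgp s (by simp [hs]))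
      obtain ⟨u, hu⟩ := hg t
      exact ⟨u, Set.mem_biUnion ht hu⟩

/-- Points not related to any point of `M` do not change the value of `f` at `M`. -/
lemma union_eq_of_not_rel {U : Type*} [Finite U] {f : Set U → Set U}
    {s : Set U → Set U → Prop} (htrans : ∀ X Y Z, s X Y → s Y Z → s X Z)
    (hs : ∀ X Y : Set U, X.Nonempty → Y.Nonempty → f (X ∪ Y) ≠ f Y → s X Y)
    (htri : ∀ X Y : Set U, X.Nonempty → Y.Nonempty →
      f (X ∪ Y) = f X ∨ f (X ∪ Y) = f Y ∨ f (X ∪ Y) = f X ∪ f Y)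
    {M N : Set U} (hM : M.Nonempty) (hMN : ∀ n ∈ N, ∀ m ∈ M, ¬ s {n} {m}) :
    f (M ∪ N) = f M := by
  by_cases hc : ∃ m ∈ M, f {m} ≠ f M
  · obtain ⟨m, hm, hfm⟩ := hc
    induction N, N.toFinite using Set.Finite.induction_on with
    | empty => simp
    | @insert n N _ _ ih =>
      have hN := ih fun k hk => hMN k (by simp [hk])
      by_contra hne
      have hMN' : (M ∪ N).Nonempty := hM.mono Set.subset_union_left
      refine hMN n (by simp) m hm (htrans _ (M ∪ N) _ (hs _ _ (by simp) hMN' ?_)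
        (hs _ _ hMN' (by simp) ?_))
      · rwa [hN, Set.singleton_union, ← Set.union_insert]
      · rw [Set.union_eq_left.2 (by simp [hm]), hN]
        exact hfm.symm
  · push Not at hc
    have hclosed : ∀ X Y : Set U, X.Nonempty → Y.Nonempty → f X = f M → f Y = f M →
        f (X ∪ Y) = f M := by
      intro X Y hX hY h1 h2
      rcases htri X Y hX hY with h | h | h <;> simp [h, h1, h2]
    have hpt : ∀ n ∈ N, f (M ∪ {n}) = f M := by
      intro n hn
      rw [Set.union_comm, ← biUnion_union_singleton _ hM]
      refine biUnion_of_union_closed (p := fun X => f X = f M) hclosed M.toFinite hM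
        (fun _ => by simp) fun m hm => ?_
      by_contra hne
      exact hMN n hn m hm (hs _ _ (by simp) (by simp) (by rwa [hc m hm]))
    rcases N.eq_empty_or_nonempty with rfl | hN
    · simp
    · rw [← biUnion_union_singleton _ hN]
      exact biUnion_of_union_closed (p := fun X => f X = f M) hclosed N.toFinite hN
        (fun _ => hM.mono Set.subset_union_left) hpt

/-- The value of `f` at `A` is the union of its values at the points of `A` of minimal rank. -/
lemma mem_iff_exists_minimal {U Z : Type*} [Finite U] [LinearOrder Z] {f : Set U → Set U}
    {s : Set U → Set U → Prop} (hrefl : ∀ X, s X X) (htrans : ∀ X Y Z, s X Y → s Y Z → s X Z)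
    (hs : ∀ X Y : Set U, X.Nonempty → Y.Nonempty → f (X ∪ Y) ≠ f Y → s X Y)
    (hsub : ∀ X Y : Set U, X.Nonempty → Y.Nonempty → f (X ∪ Y) ⊆ f X ∪ f Y)
    (hmono : ∀ X Y : Set U, X.Nonempty → Y.Nonempty → s X Y → f X ⊆ f (X ∪ Y))
    {v : U → Z} (hv : ∀ x y, s {x} {y} → v x ≤ v y)
    (hv' : ∀ x y, s {x} {y} → v y ≤ v x → s {y} {x})
    {A : Set U} (hA : A.Nonempty) (b : U) :
    b ∈ f A ↔ ∃ a ∈ A, (∀ a' ∈ A, v a ≤ v a') ∧ b ∈ f {a} := by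
  have htri : ∀ X Y : Set U, X.Nonempty → Y.Nonempty →
      f (X ∪ Y) = f X ∨ f (X ∪ Y) = f Y ∨ f (X ∪ Y) = f X ∪ f Y := by
    intro X Y hX hY
    by_cases h1 : f (X ∪ Y) = f X
    · exact Or.inl h1
    by_cases h2 : f (X ∪ Y) = f Y
    · exact Or.inr (Or.inl h2)
    have hXY := hmono X Y hX hY (hs X Y hX hY h2)
    have hYX := hmono Y X hY hX (hs Y X hY hX (by rwa [Set.union_comm]))
    rw [Set.union_comm] at hYX
    exact Or.inr (Or.inr ((hsub X Y hX hY).antisymm (Set.union_subset hXY hYX)))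
  constructor
  · intro hb
    obtain ⟨a₀, ha₀, hmin⟩ := Set.exists_min_image A v A.toFinite hA
    set M : Set U := {a | a ∈ A ∧ ∀ a' ∈ A, v a ≤ v a'}
    have hM : M.Nonempty := ⟨a₀, ha₀, hmin⟩
    have hMA : M ∪ (A \ M) = A := Set.union_sdiff_cancel fun x hx => hx.1
    have hfM : f (M ∪ (A \ M)) = f M := by
      refine union_eq_of_not_rel htrans hs htri hM fun n hn m hm h => hn.2 ⟨hn.1, fun a' ha' => ?_⟩
      exact (hv n m h).trans (hm.2 a' ha')
    rw [hMA] at hfM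
    rw [hfM] at hb
    have hcover : f (⋃ m ∈ M, {m}) ⊆ ⋃ m ∈ M, f {m} := by
      refine biUnion_of_union_closed (p := fun X => f X ⊆ ⋃ m ∈ M, f {m}) ?_ M.toFinite hM
        (fun _ => by simp) fun m hm => Set.subset_biUnion_of_mem (u := fun m => f {m}) hm
      intro X Y hX hY h1 h2
      exact (hsub X Y hX hY).trans (Set.union_subset h1 h2)
    rw [Set.biUnion_of_singleton] at hcover
    obtain ⟨m, hm, hbm⟩ := Set.mem_iUnion₂.1 (hcover hb)
    exact ⟨m, hm.1, hm.2, hbm⟩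
  · rintro ⟨a, ha, hmin, hb⟩
    set T : Set U := {t | t ∈ A ∧ s {a} {t} ∧ s {t} {a}}
    have haT : a ∈ T := ⟨ha, hrefl _, hrefl _⟩
    have hTA : T ∪ (A \ T) = A := Set.union_sdiff_cancel fun x hx => hx.1
    have hfT : f (T ∪ (A \ T)) = f T := by
      refine union_eq_of_not_rel htrans hs htri ⟨a, haT⟩ fun n hn t ht h => hn.2 ?_
      have hna := htrans _ _ _ h ht.2.2
      exact ⟨hn.1, hv' n a hna (hmin n hn.1), hna⟩
    rw [hTA] at hfT
    have hbT : b ∈ f (⋃ t ∈ T, ({a} ∪ {t} : Set U)) := by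
      refine biUnion_of_union_closed (p := fun X => b ∈ f X) ?_ T.toFinite ⟨a, haT⟩
        (fun _ => by simp) fun t ht => hmono _ _ (by simp) (by simp) ht.2.1 hb
      intro X Y hX hY h1 h2
      rcases htri X Y hX hY with h | h | h <;> simp [h, h1, h2]
    rwa [biUnion_union_singleton _ ⟨a, haT⟩, Set.union_eq_right.2 (by simpa using haT),
      ← hfT] at hbT

/-- The relation `relR` of a distance operation compares the distances between the sets. -/
lemma le_of_reflTransGen_relR {U Z : Type*} [LinearOrder Z] {op : Set U → Set U → Set U}
    {d : U → U → Z} (h : ∀ A B : Set U, A.Nonempty → B.Nonempty → op A B = distRev d A B)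
    {p q : Set U × Set U} (hpq : Relation.ReflTransGen (relR op) p q) :
    ∀ a' ∈ q.1, ∀ b' ∈ q.2, ∃ a ∈ p.1, ∃ b ∈ p.2, d a b ≤ d a' b' := by
  induction hpq with
  | refl => exact fun a' ha' b' hb' => ⟨a', ha', b', hb', le_rfl⟩
  | @tail q r _ hqr ih =>
    suffices hstep : ∀ a' ∈ r.1, ∀ b' ∈ r.2, ∃ a ∈ q.1, ∃ b ∈ q.2, d a b ≤ d a' b' by
      intro a' ha' b' hb'
      obtain ⟨a, ha, b, hb, hab⟩ := hstep a' ha' b' hb'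
      obtain ⟨c, hc, e, he, hce⟩ := ih a ha b hb
      exact ⟨c, hc, e, he, hce.trans hab⟩
    obtain ⟨A, B⟩ := q
    obtain ⟨A', B'⟩ := r
    obtain ⟨hA, hB, hA', hB', hcase⟩ := hqr
    dsimp only at *
    rcases hcase with ⟨rfl, b, hb, hbB⟩ | ⟨rfl, hne⟩
    · rw [h _ _ hA (hB.mono Set.subset_union_left)] at hb
      obtain ⟨-, a, ha, hmin⟩ := hb
      exact fun a' ha' b' hb' => ⟨a, ha, b, hbB, hmin a' ha' b' (Or.inr hb')⟩
    · by_contra! hlt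
      obtain ⟨a', ha', b', hb', hlt⟩ := hlt
      apply hne
      rw [h _ _ (hA.mono Set.subset_union_left) hB, h _ _ hA' hB]
      ext x
      constructor
      · rintro ⟨hx, a, ha | ha, hmin⟩
        · exact absurd (hmin a' (Or.inr ha') b' hb') (hlt a ha x hx).not_ge
        · exact ⟨hx, a, ha, fun c hc => hmin c (Or.inr hc)⟩
      · rintro ⟨hx, a, ha, hmin⟩
        refine ⟨hx, a, Or.inr ha, ?_⟩
        rintro c (hc | hc) e he
        · exact (hmin a' ha' b' hb').trans (hlt c hc e he).le
        · exact hmin c hc e he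

/-- Proposition 2.5 (a): for finite `U`, `op` is representable by a pseudo-distance
iff it satisfies (|1), (|A1), (|A2) and (|A3). -/
theorem representable_iff {U : Type} [Finite U] [Nonempty U]
    (op : Set U → Set U → Set U)
    (hop : ∀ A B : Set U, A.Nonempty → B.Nonempty → (op A B).Nonempty) :
    (∃ (Z : Type) (_ : LinearOrder Z) (d : U → U → Z),
        ∀ A B : Set U, A.Nonempty → B.Nonempty → op A B = distRev d A B) ↔
      ((∀ A B : Set U, A.Nonempty → B.Nonempty → op A B ⊆ B) ∧
       (∀ A A' B : Set U, A.Nonempty → A'.Nonempty → B.Nonempty →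
          op (A ∪ A') B ⊆ op A B ∪ op A' B) ∧
       (∀ A B B' : Set U, A.Nonempty → B.Nonempty → B'.Nonempty →
          Relation.ReflTransGen (relR op) (A, B) (A, B') → op A B ⊆ op A (B ∪ B')) ∧
       (∀ A A' B : Set U, A.Nonempty → A'.Nonempty → B.Nonempty →
          Relation.ReflTransGen (relR op) (A, B) (A', B) → op A B ⊆ op (A ∪ A') B)) := by
  constructor
  · rintro ⟨Z, _, d, h⟩
    refine ⟨?_, ?_, ?_, ?_⟩
    · intro A B hA hB b hb
      rw [h A B hA hB] at hb
      exact hb.1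
    · intro A A' B hA hA' hB b hb
      rw [h _ _ (hA.mono Set.subset_union_left) hB] at hb
      rw [h _ _ hA hB, h _ _ hA' hB]
      obtain ⟨hb, a, ha | ha, hmin⟩ := hb
      · exact Or.inl ⟨hb, a, ha, fun c hc => hmin c (Or.inl hc)⟩
      · exact Or.inr ⟨hb, a, ha, fun c hc => hmin c (Or.inr hc)⟩
    · intro A B B' hA hB hB' hR b hb
      rw [h _ _ hA hB] at hb
      rw [h _ _ hA (hB.mono Set.subset_union_left)]
      obtain ⟨hb, a, ha, hmin⟩ := hb
      refine ⟨Or.inl hb, a, ha, ?_⟩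
      rintro c hc e (he | he)
      · exact hmin c hc e he
      · obtain ⟨c', hc', e', he', hle⟩ := le_of_reflTransGen_relR h hR c hc e he
        exact (hmin c' hc' e' he').trans hle
    · intro A A' B hA hA' hB hR b hb
      rw [h _ _ hA hB] at hb
      rw [h _ _ (hA.mono Set.subset_union_left) hB]
      obtain ⟨hb, a, ha, hmin⟩ := hb
      refine ⟨hb, a, Or.inl ha, ?_⟩
      rintro c (hc | hc) e he
      · exact hmin c hc e he
      · obtain ⟨c', hc', e', he', hle⟩ := le_of_reflTransGen_relR h hR c hc e he
        exact (hmin c' hc' e' he').trans hle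
  · rintro ⟨h1, hA1, hA2, hA3⟩
    obtain ⟨Z, _, v, hv, hv'⟩ := exists_linear_ranking (relR op)
    refine ⟨Z, inferInstance, fun a b => v ({a}, {b}), fun A B hA hB => ?_⟩
    have hpoint : ∀ a, ∀ b ∈ B, relR op ({a}, B) ({a}, {b}) := by
      intro a b hb
      refine ⟨by simp, hB, by simp, by simp, Or.inl ⟨rfl, ?_⟩⟩
      obtain ⟨c, hc⟩ := hop {a} B (by simp) hB
      refine ⟨c, ?_, h1 _ _ (by simp) hB hc⟩
      rwa [Set.union_eq_left.2 (by simpa using hb)]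
    have hpoint_le : ∀ a, ∀ b ∈ B, v ({a}, B) ≤ v ({a}, {b}) := fun a b hb =>
      hv _ _ (.single (hpoint a b hb))
    have hmem : ∀ a, ∀ b ∈ B, b ∈ op {a} B ↔ v ({a}, {b}) ≤ v ({a}, B) := by
      intro a b hb
      have hunion : ({b} : Set U) ∪ B = B := Set.union_eq_right.2 (by simpa using hb)
      constructor
      · intro hab
        refine hv _ _ (.single ⟨by simp, by simp, by simp, hB, Or.inl ⟨rfl, b, ?_, rfl⟩⟩)
        simpa only [hunion] using hab
      · intro hle
        have hR := hv' _ _ (.single (hpoint a b hb)) hle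
        have hsub := hA2 {a} {b} B (by simp) (by simp) hB hR
        rw [hunion] at hsub
        obtain ⟨c, hc⟩ := hop {a} {b} (by simp) (by simp)
        obtain rfl : c = b := h1 {a} {b} (by simp) (by simp) hc
        exact hsub hc
    ext b
    rw [mem_iff_exists_minimal (f := fun X => op X B)
      (s := fun X Y => Relation.ReflTransGen (relR op) (X, B) (Y, B)) (v := fun a => v ({a}, B))
      (fun _ => .refl) (fun _ _ _ => .trans)
      (fun X Y hX hY hne => .single ⟨hX, hB, hY, hB, Or.inr ⟨rfl, hne⟩⟩)
      (fun X Y hX hY => hA1 X Y B hX hY hB) (fun X Y hX hY => hA3 X Y B hX hY hB)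
      (fun _ _ => hv _ _) (fun _ _ => hv' _ _) hA b]
    constructor
    · rintro ⟨a, ha, hmin, hb⟩
      have hbB := h1 _ _ (by simp) hB hb
      exact ⟨hbB, a, ha, fun a' ha' b' hb' =>
        (((hmem a b hbB).1 hb).trans (hmin a' ha')).trans (hpoint_le a' b' hb')⟩
    · rintro ⟨hbB, a, ha, hmin⟩
      have hle : ∀ a' ∈ A, v ({a}, {b}) ≤ v ({a'}, B) := by
        intro a' ha'
        obtain ⟨c, hc⟩ := hop {a'} B (by simp) hB
        have hcB := h1 _ _ (by simp) hB hc
        exact (hmin a' ha' c hcB).trans ((hmem a' c hcB).1 hc)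
      exact ⟨a, ha, fun a' ha' => (hpoint_le a b hbB).trans (hle a' ha'),
        (hmem a b hbB).2 (hle a ha)⟩
end

section
/- An operation | : 𝒴 × 𝒴 → 𝒴 on the nonempty subsets of a nonempty finite set U is representable by an identity-respecting pseudo-distance if and only if it satisfies conditions (|1), (|2), (|A1), (|A2), (|A3) and (|A4) for all nonempty subsets A, B ⊆ U, where the relation R is generated by cases (1), (2) and (3). -/
/-- The relation `R` on pairs of nonempty subsets of `U`, generated by cases (1), (2)
and (3) of Definition 2.3. -/
def relR3 {U : Type*} (op : Set U → Set U → Set U) :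
    Set U × Set U → Set U × Set U → Prop :=
  fun p q =>
    p.1.Nonempty ∧ p.2.Nonempty ∧ q.1.Nonempty ∧ q.2.Nonempty ∧
    ((p.1 = q.1 ∧ ((op p.1 (p.2 ∪ q.2)) ∩ p.2).Nonempty) ∨
     (p.2 = q.2 ∧ op (p.1 ∪ q.1) p.2 ≠ op q.1 p.2) ∨
     (p.1 ∩ p.2).Nonempty)

/-- `A × B` contains a pair which is `d`-below every pair of `A' × B'`. -/
def distLE {U Z : Type*} [LinearOrder Z] (d : U → U → Z) (p q : Set U × Set U) : Prop :=
  ∃ a ∈ p.1, ∃ b ∈ p.2, ∀ a' ∈ q.1, ∀ b' ∈ q.2, d a b ≤ d a' b'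

theorem distLE_refl {U Z : Type*} [Finite U] [LinearOrder Z] (d : U → U → Z)
    (p : Set U × Set U) (hA : p.1.Nonempty) (hB : p.2.Nonempty) : distLE d p p := by
  obtain ⟨x, hx, hmin⟩ := Set.exists_min_image (p.1 ×ˢ p.2) (fun x => d x.1 x.2)
    (Set.toFinite _) (hA.prod hB)
  exact ⟨x.1, hx.1, x.2, hx.2, fun a ha b hb => hmin (a, b) ⟨ha, hb⟩⟩

theorem distLE_trans {U Z : Type*} [LinearOrder Z] {d : U → U → Z} {p q r : Set U × Set U}
    (h₁ : distLE d p q) (h₂ : distLE d q r) : distLE d p r := by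
  obtain ⟨a, ha, b, hb, h⟩ := h₁
  obtain ⟨a', ha', b', hb', h'⟩ := h₂
  exact ⟨a, ha, b, hb, fun x hx y hy => (h a' ha' b' hb').trans (h' x hx y hy)⟩

theorem distRev_union_eq_of_not_distLE {U Z : Type*} [Finite U] [LinearOrder Z]
    {d : U → U → Z} {A A' B : Set U} (hA : A.Nonempty) (hB : B.Nonempty)
    (h : ¬ distLE d (A, B) (A', B)) : distRev d (A ∪ A') B = distRev d A' B := by
  obtain ⟨a₀, ha₀, b₀, hb₀, hmin⟩ := distLE_refl d (A, B) hA hB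
  simp only [distLE, not_exists, not_and, not_forall, not_le] at h hmin ha₀ hb₀
  obtain ⟨a₁, ha₁, b₁, hb₁, hlt⟩ := h a₀ ha₀ b₀ hb₀
  ext x
  constructor
  · rintro ⟨hx, a, ha | ha, hle⟩
    · exact absurd (hmin a ha x hx) (not_le.2 ((hle a₁ (Or.inr ha₁) b₁ hb₁).trans_lt hlt))
    · exact ⟨hx, a, ha, fun a' ha' b' hb' => hle a' (Or.inr ha') b' hb'⟩
  · rintro ⟨hx, a, ha, hle⟩
    refine ⟨hx, a, Or.inr ha, ?_⟩
    rintro a' (ha' | ha') b' hb'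
    · exact ((hle a₁ ha₁ b₁ hb₁).trans_lt hlt).le.trans (hmin a' ha' b' hb')
    · exact hle a' ha' b' hb'

theorem distLE_of_relR3 {U Z : Type*} [Finite U] [LinearOrder Z] {op : Set U → Set U → Set U}
    {d : U → U → Z} (h0 : ∀ a b c : U, d a a ≤ d b c)
    (hd : ∀ A B : Set U, A.Nonempty → B.Nonempty → op A B = distRev d A B)
    {p q : Set U × Set U} (h : relR3 op p q) : distLE d p q := by
  obtain ⟨A, B⟩ := p
  obtain ⟨A', B'⟩ := q
  obtain ⟨hA, hB, hA', hB', ⟨rfl, hne⟩ | ⟨rfl, hne⟩ | ⟨x, hxA, hxB⟩⟩ := h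
  · dsimp only at hne hA hB
    rw [hd _ _ hA (hB.mono Set.subset_union_left)] at hne
    obtain ⟨b, ⟨-, a, ha, hle⟩, hb⟩ := hne
    exact ⟨a, ha, b, hb, fun a' ha' b' hb' => hle a' ha' b' (Or.inr hb')⟩
  · by_contra hcon
    dsimp only at hne hA hB hA'
    rw [hd _ _ (hA.mono Set.subset_union_left) hB, hd _ _ hA' hB] at hne
    exact hne (distRev_union_eq_of_not_distLE hA hB hcon)
  · exact ⟨x, hxA, x, hxB, fun a' _ b' _ => h0 x a' b'⟩

theorem distLE_of_reflTransGen {U Z : Type*} [Finite U] [LinearOrder Z]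
    {op : Set U → Set U → Set U} {d : U → U → Z} (h0 : ∀ a b c : U, d a a ≤ d b c)
    (hd : ∀ A B : Set U, A.Nonempty → B.Nonempty → op A B = distRev d A B)
    {p q : Set U × Set U} (hA : p.1.Nonempty) (hB : p.2.Nonempty)
    (h : Relation.ReflTransGen (relR3 op) p q) : distLE d p q := by
  induction h with
  | refl => exact distLE_refl d p hA hB
  | tail _ h ih => exact distLE_trans ih (distLE_of_relR3 h0 hd h)

/-- A set operator which is compatible with a cost function on pairs, and which chooses between
the parts of every union, is the union of its values at the points of least cost. -/
theorem mem_iff_exists_min {U Z : Type*} [Finite U] [LinearOrder Z] (F : Set U → Set U)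
    (f : U → Z)
    (hsub : ∀ A A' : Set U, A.Nonempty → A'.Nonempty → F (A ∪ A') ⊆ F A ∪ F A')
    (hsup : ∀ A A' : Set U, A.Nonempty → A'.Nonempty → F (A ∪ A') ≠ F A' → F A ⊆ F (A ∪ A'))
    (hlt : ∀ a z, f a < f z → F {a, z} = F {a})
    (hle : ∀ a z, f a ≤ f z → F {a} ⊆ F {a, z})
    (A : Set U) (hA : A.Nonempty) (x : U) :
    x ∈ F A ↔ ∃ a ∈ A, (∀ a' ∈ A, f a ≤ f a') ∧ x ∈ F {a} := by
  induction hn : A.ncard using Nat.strong_induction_on generalizing A x with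
  | _ n ih =>
  subst hn
  have key : ∀ a ∈ A, (∀ a' ∈ A, f a ≤ f a') → F {a} ⊆ F A ∧
      (x ∈ F A → ∃ a ∈ A, (∀ a' ∈ A, f a ≤ f a') ∧ x ∈ F {a}) := by
    intro a ha hmin
    by_cases h1 : A = {a}
    · subst h1
      exact ⟨subset_rfl, fun hx => ⟨a, ha, hmin, hx⟩⟩
    obtain ⟨z, hz, hza⟩ : ∃ z ∈ A, z ≠ a := by
      by_contra! hcon
      exact h1 (Set.eq_singleton_iff_unique_mem.2 ⟨ha, hcon⟩)
    by_cases h2 : A = {a, z}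
    · subst h2
      refine ⟨hle a z (hmin z hz), fun hx => ?_⟩
      rcases (hmin z hz).lt_or_eq with h | h
      · exact ⟨a, ha, hmin, hlt a z h ▸ hx⟩
      · rcases hsub {a} {z} ⟨a, rfl⟩ ⟨z, rfl⟩ hx with hx | hx
        · exact ⟨a, ha, hmin, hx⟩
        · exact ⟨z, hz, fun a' ha' => h ▸ hmin a' ha', hx⟩
    have hCA : ({a, z} : Set U) ⊆ A := Set.insert_subset ha (Set.singleton_subset_iff.2 hz)
    have hDA : A \ {z} ⊆ A := Set.sdiff_subset
    have hC : ({a, z} : Set U).ncard < A.ncard :=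
      Set.ncard_lt_ncard (hCA.ssubset_of_ne (Ne.symm h2))
    have hD : (A \ {z}).ncard < A.ncard := Set.ncard_sdiff_singleton_lt_of_mem hz
    have haC : a ∈ ({a, z} : Set U) := Or.inl rfl
    have haD : a ∈ A \ {z} := ⟨ha, fun h => hza h.symm⟩
    have hun : ({a, z} : Set U) ∪ A \ {z} = A := by
      ext y
      by_cases hy : y = z <;> by_cases hy' : y = a <;> simp_all
    have lift : ∀ S ⊆ A, S.ncard < A.ncard → a ∈ S → F {a} ⊆ F S ∧
        (x ∈ F S → ∃ a ∈ A, (∀ a' ∈ A, f a ≤ f a') ∧ x ∈ F {a}) := by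
      intro S hS hcard haS
      refine ⟨fun y hy => (ih _ hcard S ⟨a, haS⟩ y rfl).2
        ⟨a, haS, fun a' ha' => hmin a' (hS ha'), hy⟩, fun hx => ?_⟩
      obtain ⟨c, hc, hcmin, hxc⟩ := (ih _ hcard S ⟨a, haS⟩ x rfl).1 hx
      exact ⟨c, hS hc, fun a' ha' => (hcmin a haS).trans (hmin a' ha'), hxc⟩
    obtain ⟨hC₁, hC₂⟩ := lift _ hCA hC haC
    obtain ⟨hD₁, hD₂⟩ := lift _ hDA hD haD
    have hsub' := hsub _ _ ⟨a, haC⟩ ⟨a, haD⟩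
    have hsup' := hsup _ _ ⟨a, haC⟩ ⟨a, haD⟩
    rw [hun] at hsub' hsup'
    refine ⟨?_, fun hx => (hsub' hx).elim hC₂ hD₂⟩
    by_cases he : F A = F (A \ {z})
    · exact he ▸ hD₁
    · exact hC₁.trans (hsup' he)
  constructor
  · intro hx
    obtain ⟨a, ha, hmin⟩ := Set.exists_min_image A f (Set.toFinite _) hA
    exact (key a ha hmin).2 hx
  · rintro ⟨a, ha, hmin, hx⟩
    exact (key a ha hmin).1 hx

/-- Every preorder relation `r` is contained in a total one that keeps strict comparisons strict;
the total preorder is given as the pullback of a linear order. -/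
theorem exists_linear_pullback {α : Type} (r : α → α → Prop) (hr : ∀ x, r x x)
    (ht : ∀ x y z, r x y → r y z → r x z) :
    ∃ (Z : Type) (_ : LinearOrder Z) (g : α → Z), Function.Surjective g ∧
      (∀ x y, r x y → g x ≤ g y) ∧ ∀ x y, r x y → g y ≤ g x → r y x := by
  let _ : Preorder α := { le := r, le_refl := hr, le_trans := ht }
  refine ⟨LinearExtension (Antisymmetrization α (· ≤ ·)), inferInstance,
    fun x => toLinearExtension (toAntisymmetrization (· ≤ ·) x), ?_, ?_, ?_⟩
  · intro z
    obtain ⟨x, hx⟩ := Quotient.exists_rep (s := AntisymmRel.setoid α (· ≤ ·)) z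
    exact ⟨x, hx⟩
  · intro x y h
    exact toLinearExtension.monotone (toAntisymmetrization_mono (show x ≤ y from h))
  · intro x y h h'
    have h₁ := toLinearExtension.monotone (toAntisymmetrization_mono (show x ≤ y from h))
    have h₂ : toAntisymmetrization (· ≤ ·) x = toAntisymmetrization (· ≤ ·) y :=
      le_antisymm (α := LinearExtension (Antisymmetrization α (· ≤ ·))) h₁ h'
    exact (Quotient.exact h₂ : AntisymmRel (· ≤ ·) x y).2


/-- Proposition 2.5 (b): for finite `U`, `op` is representable by an identity-respecting
pseudo-distance iff it satisfies (|1), (|2), (|A1), (|A2), (|A3) and (|A4). -/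
theorem representable_id_iff {U : Type} [Finite U] [Nonempty U]
    (op : Set U → Set U → Set U)
    (hop : ∀ A B : Set U, A.Nonempty → B.Nonempty → (op A B).Nonempty) :
    (∃ (Z : Type) (_ : LinearOrder Z) (d : U → U → Z),
        (∃ z0 : Z, (∀ z : Z, z0 ≤ z) ∧ ∀ a b : U, d a b = z0 ↔ a = b) ∧
        ∀ A B : Set U, A.Nonempty → B.Nonempty → op A B = distRev d A B) ↔
      ((∀ A B : Set U, A.Nonempty → B.Nonempty → op A B ⊆ B) ∧
       (∀ A B : Set U, A.Nonempty → B.Nonempty → (A ∩ B).Nonempty → op A B = A ∩ B) ∧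
       (∀ A A' B : Set U, A.Nonempty → A'.Nonempty → B.Nonempty →
          op (A ∪ A') B ⊆ op A B ∪ op A' B) ∧
       (∀ A B B' : Set U, A.Nonempty → B.Nonempty → B'.Nonempty →
          Relation.ReflTransGen (relR3 op) (A, B) (A, B') → op A B ⊆ op A (B ∪ B')) ∧
       (∀ A A' B : Set U, A.Nonempty → A'.Nonempty → B.Nonempty →
          Relation.ReflTransGen (relR3 op) (A, B) (A', B) → op A B ⊆ op (A ∪ A') B) ∧
       (∀ A B A' B' : Set U, A.Nonempty → B.Nonempty → A'.Nonempty → B'.Nonempty →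
          Relation.ReflTransGen (relR3 op) (A, B) (A', B') → (A' ∩ B').Nonempty →
          (A ∩ B).Nonempty)) := by
  constructor
  · rintro ⟨Z, _, d, ⟨z0, hz0, hid⟩, hd⟩
    have h0 : ∀ a b c : U, d a a ≤ d b c := fun a b c => (hid a a).2 rfl ▸ hz0 _
    refine ⟨?_, ?_, ?_, ?_, ?_, ?_⟩
    · intro A B hA hB
      rw [hd A B hA hB]
      exact fun x hx => hx.1
    · rintro A B hA hB ⟨c, hcA, hcB⟩
      rw [hd A B hA hB]
      ext x
      constructor
      · rintro ⟨hx, a, ha, hle⟩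
        have : a = x := (hid a x).1 (le_antisymm ((hid c c).2 rfl ▸ hle c hcA c hcB) (hz0 _))
        exact ⟨this ▸ ha, hx⟩
      · rintro ⟨hxA, hxB⟩
        exact ⟨hxB, x, hxA, fun a' _ b' _ => h0 x a' b'⟩
    · intro A A' B hA hA' hB
      rw [hd A B hA hB, hd A' B hA' hB, hd _ B (hA.mono Set.subset_union_left) hB]
      rintro x ⟨hx, a, ha | ha, hle⟩
      · exact Or.inl ⟨hx, a, ha, fun a' ha' => hle a' (Or.inl ha')⟩
      · exact Or.inr ⟨hx, a, ha, fun a' ha' => hle a' (Or.inr ha')⟩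
    · intro A B B' hA hB hB' h
      obtain ⟨a, ha, b, hb, hab⟩ := distLE_of_reflTransGen h0 hd (p := (A, B)) hA hB h
      rw [hd A B hA hB, hd A _ hA (hB.mono Set.subset_union_left)]
      rintro x ⟨hx, c, hc, hle⟩
      refine ⟨Or.inl hx, c, hc, ?_⟩
      rintro a' ha' b' (hb' | hb')
      · exact hle a' ha' b' hb'
      · exact (hle a ha b hb).trans (hab a' ha' b' hb')
    · intro A A' B hA hA' hB h
      obtain ⟨a, ha, b, hb, hab⟩ := distLE_of_reflTransGen h0 hd (p := (A, B)) hA hB h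
      rw [hd A B hA hB, hd _ B (hA.mono Set.subset_union_left) hB]
      rintro x ⟨hx, c, hc, hle⟩
      refine ⟨hx, c, Or.inl hc, ?_⟩
      rintro a' (ha' | ha') b' hb'
      · exact hle a' ha' b' hb'
      · exact (hle a ha b hb).trans (hab a' ha' b' hb')
    · rintro A B A' B' hA hB hA' hB' h ⟨c, hcA, hcB⟩
      obtain ⟨a, ha, b, hb, hab⟩ := distLE_of_reflTransGen h0 hd (p := (A, B)) hA hB h
      have : a = b := (hid a b).1 (le_antisymm ((hid c c).2 rfl ▸ hab c hcA c hcB) (hz0 _))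
      exact ⟨a, ha, this ▸ hb⟩
  · rintro ⟨H1, -, HA1, HA2, HA3, HA4⟩
    obtain ⟨Z, hZ, g, hsurj, hmono, hstrict⟩ := exists_linear_pullback
      (fun x y : U × U => Relation.ReflTransGen (relR3 op) ({x.1}, {x.2}) ({y.1}, {y.2}))
      (fun _ => .refl) (fun _ _ _ h h' => h.trans h')
    have hs : ∀ a : U, ({a} : Set U).Nonempty := Set.singleton_nonempty
    have hdiag : ∀ (a : U) (x : U × U),
        Relation.ReflTransGen (relR3 op) ({a}, {a}) ({x.1}, {x.2}) := fun a x =>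
      .single ⟨hs _, hs _, hs _, hs _, Or.inr (Or.inr ⟨a, rfl, rfl⟩)⟩
    have down : ∀ (A B : Set U) (b : U), A.Nonempty → b ∈ B →
        Relation.ReflTransGen (relR3 op) (A, B) (A, {b}) := by
      intro A B b hA hb
      refine .single ⟨hA, ⟨b, hb⟩, hA, hs b, Or.inl ⟨rfl, ?_⟩⟩
      dsimp only
      rw [Set.union_eq_self_of_subset_right (Set.singleton_subset_iff.2 hb)]
      obtain ⟨x, hx⟩ := hop A B hA ⟨b, hb⟩
      exact ⟨x, hx, H1 A B hA ⟨b, hb⟩ hx⟩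
    have up : ∀ (A B : Set U) (b : U), A.Nonempty → B.Nonempty → b ∈ op A B →
        Relation.ReflTransGen (relR3 op) (A, {b}) (A, B) := by
      intro A B b hA hB hb
      refine .single ⟨hA, hs b, hA, hB, Or.inl ⟨rfl, ?_⟩⟩
      dsimp only
      rw [Set.union_eq_self_of_subset_left (Set.singleton_subset_iff.2 (H1 A B hA hB hb))]
      exact ⟨b, hb, rfl⟩
    have single : ∀ a b : U, op {a} {b} = {b} := fun a b =>
      (Set.subset_singleton_iff_eq.1 (H1 _ _ (hs a) (hs b))).resolve_left
        (hop _ _ (hs a) (hs b)).ne_empty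
    have hmem : ∀ (a : U) (B : Set U) (b : U), b ∈ B →
        (b ∈ op {a} B ↔ ∀ b' ∈ B, g (a, b) ≤ g (a, b')) := by
      intro a B b hb
      constructor
      · intro h b' hb'
        exact hmono (a, b) (a, b') ((up _ _ b (hs a) ⟨b, hb⟩ h).trans (down _ _ b' (hs a) hb'))
      · intro h
        obtain ⟨c, hc⟩ := hop {a} B (hs a) ⟨b, hb⟩
        have hcB := H1 _ _ (hs a) ⟨b, hb⟩ hc
        have hcb := (up _ _ c (hs a) ⟨b, hb⟩ hc).trans (down _ _ b (hs a) hb)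
        have hbc := (hstrict (a, c) (a, b) hcb (h c hcB)).trans (up _ _ c (hs a) ⟨b, hb⟩ hc)
        have := HA2 _ _ _ (hs a) (hs b) ⟨b, hb⟩ hbc
        rw [single, Set.union_eq_self_of_subset_left (Set.singleton_subset_iff.2 hb)] at this
        exact this rfl
    refine ⟨Z, hZ, fun a b => g (a, b), ?_, ?_⟩
    · obtain ⟨c⟩ := ‹Nonempty U›
      refine ⟨g (c, c), fun z => ?_, fun a b => ⟨fun h => ?_, ?_⟩⟩
      · obtain ⟨x, rfl⟩ := hsurj z
        exact hmono _ _ (hdiag c x)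
      · have := hstrict (c, c) (a, b) (hdiag c (a, b)) h.le
        obtain ⟨x, hxa, hxb⟩ := HA4 _ _ _ _ (hs a) (hs b) (hs c) (hs c) this ⟨c, rfl, rfl⟩
        exact (Set.mem_singleton_iff.1 hxa).symm.trans (Set.mem_singleton_iff.1 hxb)
      · rintro rfl
        exact le_antisymm (hmono _ _ (hdiag a (c, c))) (hmono _ _ (hdiag c (a, a)))
    · intro A B hA hB
      choose r hr using fun a : U => hop {a} B (hs a) hB
      have hrB : ∀ a, r a ∈ B := fun a => H1 _ _ (hs a) hB (hr a)
      have hrmin : ∀ a, ∀ b ∈ B, g (a, r a) ≤ g (a, b) := fun a =>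
        (hmem a B (r a) (hrB a)).1 (hr a)
      have toPt : ∀ a z, Relation.ReflTransGen (relR3 op) ({a}, B) ({z}, B) →
          Relation.ReflTransGen (relR3 op) ({a}, {r a}) ({z}, {r z}) := fun a z h =>
        (up _ _ _ (hs a) hB (hr a)).trans (h.trans (down _ _ _ (hs z) (hrB z)))
      have ofPt : ∀ a z, Relation.ReflTransGen (relR3 op) ({a}, {r a}) ({z}, {r z}) →
          Relation.ReflTransGen (relR3 op) ({a}, B) ({z}, B) := fun a z h =>
        (down _ _ _ (hs a) (hrB a)).trans (h.trans (up _ _ _ (hs z) hB (hr z)))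
      have step : ∀ A A' : Set U, A.Nonempty → A'.Nonempty → op (A ∪ A') B ≠ op A' B →
          Relation.ReflTransGen (relR3 op) (A, B) (A', B) := fun A A' hA hA' h =>
        .single ⟨hA, hB, hA', hB, Or.inr (Or.inl ⟨rfl, h⟩)⟩
      have stepPt : ∀ a z : U, op {a, z} B ≠ op {z} B →
          Relation.ReflTransGen (relR3 op) ({a}, B) ({z}, B) := fun a z h =>
        step {a} {z} (hs a) (hs z) h
      ext x
      rw [mem_iff_exists_min (fun A => op A B) (fun a => g (a, r a))
        (fun A A' hA hA' => HA1 A A' B hA hA' hB)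
        (fun A A' hA hA' h => HA3 A A' B hA hA' hB (step A A' hA hA' h)) ?_ ?_ A hA x]
      · constructor
        · rintro ⟨a, ha, hmin, hx⟩
          have hxB := H1 _ _ (hs a) hB hx
          exact ⟨hxB, a, ha, fun a' ha' b' hb' =>
            ((hmem a B x hxB).1 hx _ (hrB a)).trans ((hmin a' ha').trans (hrmin a' b' hb'))⟩
        · rintro ⟨hxB, a, ha, hle⟩
          exact ⟨a, ha, fun a' ha' => (hrmin a x hxB).trans (hle a' ha' _ (hrB a')),
            (hmem a B x hxB).2 (hle a ha)⟩
      · intro a z hlt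
        by_contra hne
        have := stepPt z a (by rwa [Set.pair_comm])
        exact hlt.not_ge (hmono (z, r z) (a, r a) (toPt z a this))
      · intro a z hle
        by_cases h1 : op {a, z} B = op {a} B
        · exact h1.ge
        have hza := stepPt z a (by rwa [Set.pair_comm])
        have haz := ofPt a z (hstrict (z, r z) (a, r a) (toPt z a hza) hle)
        exact HA3 {a} {z} B (hs a) (hs z) hB haz
end

section
/- If the operation | satisfies conditions (|1), (|A1), (|A2) and (|A3), then for any nonempty subsets A, A', B of U: (A | B) ∩ (A' | B) ⊆ (A ∪ A') | B. -/
/-- Lemma 2.6: if `op` satisfies (|1), (|A1), (|A2) and (|A3), then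
`(A | B) ∩ (A' | B) ⊆ (A ∪ A') | B`. -/
theorem inter_subset_union_rev {U : Type} [Finite U] [Nonempty U]
    (op : Set U → Set U → Set U)
    (hop : ∀ A B : Set U, A.Nonempty → B.Nonempty → (op A B).Nonempty)
    (h1 : ∀ A B : Set U, A.Nonempty → B.Nonempty → op A B ⊆ B)
    (hA1 : ∀ A A' B : Set U, A.Nonempty → A'.Nonempty → B.Nonempty →
        op (A ∪ A') B ⊆ op A B ∪ op A' B)
    (hA2 : ∀ A B B' : Set U, A.Nonempty → B.Nonempty → B'.Nonempty →
        Relation.ReflTransGen (relR op) (A, B) (A, B') → op A B ⊆ op A (B ∪ B'))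
    (hA3 : ∀ A A' B : Set U, A.Nonempty → A'.Nonempty → B.Nonempty →
        Relation.ReflTransGen (relR op) (A, B) (A', B) → op A B ⊆ op (A ∪ A') B)
    (A A' B : Set U) (hA : A.Nonempty) (hA' : A'.Nonempty) (hB : B.Nonempty) :
    op A B ∩ op A' B ⊆ op (A ∪ A') B := by
  rintro x ⟨hx, hx'⟩
  by_cases h : op (A ∪ A') B = op A' B
  · rwa [h]
  · exact hA3 A A' B hA hA' hB
      (.single ⟨hA, hB, hA', hB, Or.inr ⟨rfl, h⟩⟩) hx
end

section
/- Let d be a pseudo-distance on U and let A, B, C ⊆ U be subsets such that (A |_d B) ∩ C ≠ ∅. Then A |_d (B ∩ C) = (A |_d B) ∩ C. -/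
/-- If `(A |_d B) ∩ C ≠ ∅`, then `A |_d (B ∩ C) = (A |_d B) ∩ C`. -/
theorem distRev_inter {U Z : Type*} [LinearOrder Z] (d : U → U → Z)
    (A B C : Set U) (h : (distRev d A B ∩ C).Nonempty) :
    distRev d A (B ∩ C) = distRev d A B ∩ C := by
  obtain ⟨b₀, ⟨hb₀, a₀, ha₀, hmin⟩, hc₀⟩ := h
  ext b
  constructor
  · rintro ⟨⟨hb, hc⟩, a, ha, hab⟩
    exact ⟨⟨hb, a, ha, fun a' ha' b' hb' =>
      (hab a₀ ha₀ b₀ ⟨hb₀, hc₀⟩).trans (hmin a' ha' b' hb')⟩, hc⟩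
  · rintro ⟨⟨hb, a, ha, hab⟩, hc⟩
    exact ⟨⟨hb, hc⟩, a, ha, fun a' ha' b' hb' => hab a' ha' b' hb'.1⟩
end

section
/- Let d be a symmetric pseudo-distance on U such that A |_d B ≠ ∅ for all nonempty subsets A, B ⊆ U. Then the operation |_d satisfies the Loop condition: for all nonempty subsets X₀, X₁, …, X_k ⊆ U, if (X₁ |_d (X₀ ∪ X₂)) ∩ X₀ ≠ ∅, (X₂ |_d (X₁ ∪ X₃)) ∩ X₁ ≠ ∅, …, and (X_k |_d (X_{k−1} ∪ X₀)) ∩ X_{k−1} ≠ ∅, then (X₀ |_d (X_k ∪ X₁)) ∩ X₁ ≠ ∅. -/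
/-- For a symmetric pseudo-distance `d` whose revision operator is consistency
preserving, the operation `|_d` satisfies the Loop condition (|S1). -/
theorem distRev_loop {U Z : Type*} [LinearOrder Z] (d : U → U → Z)
    (hsym : ∀ a b : U, d a b = d b a)
    (hne : ∀ A B : Set U, A.Nonempty → B.Nonempty → (distRev d A B).Nonempty)
    (k : ℕ) (hk : 1 ≤ k) (X : ℕ → Set U) (hX : ∀ i ≤ k, (X i).Nonempty)
    (hchain : ∀ i, 1 ≤ i → i < k →
        ((distRev d (X i) (X (i - 1) ∪ X (i + 1))) ∩ X (i - 1)).Nonempty)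
    (hlast : ((distRev d (X k) (X (k - 1) ∪ X 0)) ∩ X (k - 1)).Nonempty) :
    ((distRev d (X 0) (X k ∪ X 1)) ∩ X 1).Nonempty := by
  obtain ⟨b, hb, a, ha, hab⟩ := hne (X 0) (X 1) (hX 0 (Nat.zero_le k)) (hX 1 hk)
  have hmin : ∀ i < k, ∀ x ∈ X i, ∀ y ∈ X (i + 1), d a b ≤ d x y := by
    intro i
    induction i with
    | zero => exact fun _ => hab
    | succ i ih =>
      intro hi x hx y hy
      obtain ⟨q, ⟨-, p, hp, hpq⟩, hq⟩ := hchain (i + 1) (Nat.le_add_left 1 i) hi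
      calc d a b ≤ d q p := ih (Nat.lt_of_succ_lt hi) q hq p hp
        _ = d p q := hsym q p
        _ ≤ d x y := hpq x hx y (Or.inr hy)
  have hclose : ∀ x ∈ X k, ∀ y ∈ X 0, d a b ≤ d x y := by
    intro x hx y hy
    obtain ⟨q, ⟨-, p, hp, hpq⟩, hq⟩ := hlast
    calc d a b ≤ d q p :=
          hmin (k - 1) (Nat.sub_lt hk one_pos) q hq p (by rwa [Nat.sub_add_cancel hk])
      _ = d p q := hsym q p
      _ ≤ d x y := hpq x hx y (Or.inr hy)
  refine ⟨b, ⟨Or.inr hb, a, ha, ?_⟩, hb⟩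
  rintro x hx y (hy | hy)
  · exact (hclose y hy x hx).trans_eq (hsym y x)
  · exact hab x hx y hy
end

section
/- Let d be a pseudo-distance on U and let A, A', B ⊆ U be nonempty finite subsets with d(A,B) ≤ d(A',B). Then A |_d B ⊆ (A ∪ A') |_d B. -/
/-- `d(A,B) := min {d(a,b) : a ∈ A, b ∈ B}` for nonempty finite sets. -/
def dmin {U Z : Type*} [LinearOrder Z] (d : U → U → Z) (A B : Finset U)
    (hA : A.Nonempty) (hB : B.Nonempty) : Z :=
  (A ×ˢ B).inf' (hA.product hB) fun p => d p.1 p.2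

/-- If `d(A,B) ≤ d(A',B)`, then `A |_d B ⊆ (A ∪ A') |_d B`. -/
theorem distRev_subset_union_left {U Z : Type*} [LinearOrder Z] [DecidableEq U]
    (d : U → U → Z) (A A' B : Finset U)
    (hA : A.Nonempty) (hA' : A'.Nonempty) (hB : B.Nonempty)
    (hle : dmin d A B hA hB ≤ dmin d A' B hA' hB) :
    distRev d (↑A) (↑B) ⊆ distRev d (↑(A ∪ A')) (↑B) := by
  rintro b ⟨hb, a, ha, hmin⟩
  refine ⟨hb, a, by simp_all, fun a' ha' b' hb' => ?_⟩
  rw [Finset.mem_coe, Finset.mem_union] at ha'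
  obtain h | h := ha'
  · exact hmin a' h b' hb'
  · calc d a b ≤ dmin d A B hA hB :=
          Finset.le_inf' _ _ fun p hp =>
            hmin p.1 (Finset.mem_product.1 hp).1 p.2 (Finset.mem_product.1 hp).2
      _ ≤ dmin d A' B hA' hB := hle
      _ ≤ d a' b' :=
          Finset.inf'_le (fun p : U × U => d p.1 p.2) (Finset.mk_mem_product h hb')
end

section
/- Suppose the operation | satisfies conditions (|1) and (|S1). If b ∈ A | B, a_b ∈ {b} | A, a_b ∈ A' and A' ⊆ A with A' ∈ 𝒴, then: (a) b ∈ A' | B, and (b) A' | B ⊆ A | B. -/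
/-- Fact 2.3 (7): if `b ∈ A | B`, `a_b ∈ {b} | A`, `a_b ∈ A' ⊆ A`, then
`b ∈ A' | B` and `A' | B ⊆ A | B`. -/
theorem rev_subset_of_witness {U : Type*} [Nonempty U] (Y : Set (Set U))
    (hY0 : ∅ ∉ Y) (hYsingle : ∀ a : U, {a} ∈ Y)
    (hYinter : ∀ A ∈ Y, ∀ B ∈ Y, (A ∩ B).Nonempty → A ∩ B ∈ Y)
    (hYunion : ∀ A ∈ Y, ∀ B ∈ Y, A ∪ B ∈ Y)
    (op : Set U → Set U → Set U)
    (hop : ∀ A ∈ Y, ∀ B ∈ Y, op A B ∈ Y)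
    (h1 : ∀ A ∈ Y, ∀ B ∈ Y, op A B ⊆ B)
    (hloop : LoopCond Y op)
    (A B A' : Set U) (hA : A ∈ Y) (hB : B ∈ Y) (hA' : A' ∈ Y)
    (b ab : U) (hb : b ∈ op A B) (hab : ab ∈ op {b} A)
    (habA' : ab ∈ A') (hsub : A' ⊆ A) :
    b ∈ op A' B ∧ op A' B ⊆ op A B := by
  have hne : ∀ P ∈ Y, P.Nonempty := fun P hP =>
    Set.nonempty_iff_ne_empty.2 fun h => hY0 (h ▸ hP)
  -- the part of `Q` closest to `P` meets every superset of `Q`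
  have hmeet : ∀ P ∈ Y, ∀ Q ∈ Y, ∀ R, Q ⊆ R → (op P Q ∩ R).Nonempty := by
    intro P hP Q hQ R hQR
    obtain ⟨x, hx⟩ := hne _ (hop P hP Q hQ)
    exact ⟨x, hx, hQR (h1 P hP Q hQ hx)⟩
  have hbB : {b} ⊆ B := Set.singleton_subset_iff.2 (h1 A hA B hB hb)
  have hbA' : (op {b} (A' ∪ A) ∩ A').Nonempty := by
    rw [Set.union_eq_right.2 hsub]
    exact ⟨ab, hab, habA'⟩
  have hbA : (op A ({b} ∪ B) ∩ {b}).Nonempty := by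
    rw [Set.union_eq_right.2 hbB]
    exact ⟨b, hb, rfl⟩
  constructor
  · obtain ⟨x, hx, rfl⟩ := hloop 3
      (fun | 0 => A' | 1 => {b} | 2 => A | _ => B) (by norm_num)
      (by intro i hi; interval_cases i <;> simp [*])
      (by
        intro i hi hi'
        interval_cases i
        · exact hbA'
        · exact hbA)
      (by
        change (op B (A ∪ A') ∩ A).Nonempty
        rw [Set.union_eq_left.2 hsub]
        exact hmeet B hB A hA A subset_rfl)
    change x ∈ op A' (B ∪ {x}) at hx
    rwa [Set.union_eq_left.2 hbB] at hx
  · intro c hc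
    have hcB : {c} ⊆ B := Set.singleton_subset_iff.2 (h1 A' hA' B hB hc)
    obtain ⟨x, hx, rfl⟩ := hloop 7
      (fun | 0 => A | 1 => {c} | 2 => A' | 3 => B | 4 => A' | 5 => {b} | 6 => A | _ => B)
      (by norm_num)
      (by intro i hi; interval_cases i <;> simp [*])
      (by
        intro i hi hi'
        interval_cases i
        · change (op {c} (A ∪ A') ∩ A).Nonempty
          rw [Set.union_eq_left.2 hsub]
          exact hmeet _ (hYsingle c) A hA A subset_rfl
        · change (op A' ({c} ∪ B) ∩ {c}).Nonempty
          rw [Set.union_eq_right.2 hcB]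
          exact ⟨c, hc, rfl⟩
        · change (op B (A' ∪ A') ∩ A').Nonempty
          rw [Set.union_self]
          exact hmeet B hB A' hA' A' subset_rfl
        · change (op A' (B ∪ {b}) ∩ B).Nonempty
          rw [Set.union_eq_left.2 hbB]
          exact hmeet A' hA' B hB B subset_rfl
        · exact hbA'
        · exact hbA)
      (by
        change (op B (A ∪ A) ∩ A).Nonempty
        rw [Set.union_self]
        exact hmeet B hB A hA A subset_rfl)
    change x ∈ op A (B ∪ {x}) at hx
    rwa [Set.union_eq_left.2 hcB] at hx
end

section
/- Let d be a pseudo-distance on U and let A₁, A₂, B, C ⊆ U be nonempty finite subsets such that A₁ |_d B, A₂ |_d B and (A₁ ∪ A₂) |_d B are nonempty. Then: (i) ((A₁ |_d B) |_d C) ∩ ((A₂ |_d B) |_d C) ⊆ ((A₁ ∪ A₂) |_d B) |_d C, and (ii) ((A₁ ∪ A₂) |_d B) |_d C ⊆ ((A₁ |_d B) |_d C) ∪ ((A₂ |_d B) |_d C). -/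
theorem distRev_union_subset {U Z : Type*} [LinearOrder Z] (d : U → U → Z) (A₁ A₂ B : Set U) :
    distRev d (A₁ ∪ A₂) B ⊆ distRev d A₁ B ∪ distRev d A₂ B := by
  rintro b ⟨hb, a, ha | ha, h⟩
  · exact Or.inl ⟨hb, a, ha, fun a' ha' => h a' (Or.inl ha')⟩
  · exact Or.inr ⟨hb, a, ha, fun a' ha' => h a' (Or.inr ha')⟩

theorem inter_distRev_subset_distRev_union {U Z : Type*} [LinearOrder Z] (d : U → U → Z)
    (A₁ A₂ B : Set U) :
    distRev d A₁ B ∩ distRev d A₂ B ⊆ distRev d (A₁ ∪ A₂) B := by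
  rintro b ⟨⟨hb, a₁, ha₁, h₁⟩, -, a₂, ha₂, h₂⟩
  rcases le_total (d a₁ b) (d a₂ b) with h | h
  · exact ⟨hb, a₁, Or.inl ha₁, fun a' ha' b' hb' =>
      ha'.elim (h₁ a' · b' hb') fun ha' => h.trans (h₂ a' ha' b' hb')⟩
  · exact ⟨hb, a₂, Or.inr ha₂, fun a' ha' b' hb' =>
      ha'.elim (fun ha' => h.trans (h₁ a' ha' b' hb')) (h₂ a' · b' hb')⟩

/-- If the minimal distance from `A₁` to `B` is at most the minimal distance from `A₂` to `B`,
then every element of `B` closest to `A₁` is closest to `A₁ ∪ A₂`. -/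
theorem distRev_subset_distRev_union {U Z : Type*} [LinearOrder Z] {d : U → U → Z}
    {A₁ A₂ B : Set U} {a₁ b₁ : U} (ha₁ : a₁ ∈ A₁) (hb₁ : b₁ ∈ B)
    (h : ∀ a ∈ A₂, ∀ b ∈ B, d a₁ b₁ ≤ d a b) :
    distRev d A₁ B ⊆ distRev d (A₁ ∪ A₂) B := by
  rintro b ⟨hb, a, ha, hab⟩
  exact ⟨hb, a, Or.inl ha, fun a' ha' b' hb' =>
    ha'.elim (hab a' · b' hb') fun ha' => (hab a₁ ha₁ b₁ hb₁).trans (h a' ha' b' hb')⟩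

/-- If `A₁` is strictly closer to `B` than `A₂`, then `A₂` does not contribute. -/
theorem distRev_union_eq_left {U Z : Type*} [LinearOrder Z] {d : U → U → Z}
    {A₁ A₂ B : Set U} {a₁ b₁ : U} (ha₁ : a₁ ∈ A₁) (hb₁ : b₁ ∈ B)
    (h : ∀ a ∈ A₂, ∀ b ∈ B, d a₁ b₁ < d a b) :
    distRev d (A₁ ∪ A₂) B = distRev d A₁ B := by
  refine Set.Subset.antisymm ?_
    (distRev_subset_distRev_union ha₁ hb₁ fun a ha b hb => (h a ha b hb).le)
  rintro b ⟨hb, a, ha | ha, hab⟩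
  · exact ⟨hb, a, ha, fun a' ha' => hab a' (Or.inl ha')⟩
  · exact absurd (hab a₁ (Or.inl ha₁) b₁ hb₁) (h a ha b hb).not_ge

theorem distRev_union_eq {U Z : Type*} [LinearOrder Z] {d : U → U → Z} {A₁ A₂ B : Set U}
    (h₁ : (distRev d A₁ B).Nonempty) (h₂ : (distRev d A₂ B).Nonempty) :
    distRev d (A₁ ∪ A₂) B = distRev d A₁ B ∨ distRev d (A₁ ∪ A₂) B = distRev d A₂ B ∨
      distRev d (A₁ ∪ A₂) B = distRev d A₁ B ∪ distRev d A₂ B := by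
  obtain ⟨b₁, hb₁, a₁, ha₁, hmin₁⟩ := h₁
  obtain ⟨b₂, hb₂, a₂, ha₂, hmin₂⟩ := h₂
  rcases lt_trichotomy (d a₁ b₁) (d a₂ b₂) with h | h | h
  · exact Or.inl (distRev_union_eq_left ha₁ hb₁ fun a ha b hb => h.trans_le (hmin₂ a ha b hb))
  · refine Or.inr (Or.inr ((distRev_union_subset d A₁ A₂ B).antisymm (Set.union_subset ?_ ?_)))
    · exact distRev_subset_distRev_union ha₁ hb₁ (h ▸ hmin₂)
    · rw [Set.union_comm]
      exact distRev_subset_distRev_union ha₂ hb₂ (h ▸ hmin₁)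
  · rw [Set.union_comm]
    exact Or.inr (Or.inl
      (distRev_union_eq_left ha₂ hb₂ fun a ha b hb => h.trans_le (hmin₁ a ha b hb)))

/-- Iterated-revision properties: for nonempty finite `A₁, A₂, B, C` with the
relevant revisions nonempty,
`((A₁ |_d B) |_d C) ∩ ((A₂ |_d B) |_d C) ⊆ ((A₁ ∪ A₂) |_d B) |_d C` and
`((A₁ ∪ A₂) |_d B) |_d C ⊆ ((A₁ |_d B) |_d C) ∪ ((A₂ |_d B) |_d C)`. -/
theorem iterated_rev_union {U Z : Type*} [LinearOrder Z] (d : U → U → Z)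
    (A₁ A₂ B C : Set U)
    (hA₁f : A₁.Finite) (hA₂f : A₂.Finite) (hBf : B.Finite) (hCf : C.Finite)
    (hA₁ : A₁.Nonempty) (hA₂ : A₂.Nonempty) (hB : B.Nonempty) (hC : C.Nonempty)
    (h1 : (distRev d A₁ B).Nonempty) (h2 : (distRev d A₂ B).Nonempty)
    (h12 : (distRev d (A₁ ∪ A₂) B).Nonempty) :
    (distRev d (distRev d A₁ B) C ∩ distRev d (distRev d A₂ B) C
        ⊆ distRev d (distRev d (A₁ ∪ A₂) B) C) ∧
    (distRev d (distRev d (A₁ ∪ A₂) B) C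
        ⊆ distRev d (distRev d A₁ B) C ∪ distRev d (distRev d A₂ B) C) := by
  rcases distRev_union_eq h1 h2 with h | h | h <;> rw [h]
  · exact ⟨Set.inter_subset_left, Set.subset_union_left⟩
  · exact ⟨Set.inter_subset_right, Set.subset_union_right⟩
  · exact ⟨inter_distRev_subset_distRev_union d _ _ C, distRev_union_subset d _ _ C⟩
end
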